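/- Let d ≥ 1 and Π a connective (d+1)-Calabi-Yau dg algebra with H^0Π finite dimensional. For each l ≥ 0, the truncation Π^{≤−l}[−l] lies in the fundamental domain F = addΠ * addΠ[1] * ... * addΠ[d−1] of per Π, and its image in the cluster category C(Π) is isomorphic to Π[−l]. -/

import Mathlib

/-!
STATEMENT 13: Let Π be a connective (d+1)-Calabi-Yau dg algebra with H⁰Π finite
dimensional, d ≥ 1. For each l ≥ 0 the truncation Π^{≤-l}[-l] lies in the
fundamental domain F = addΠ * addΠ[1] * ... * addΠ[d-1] of per Π, and its image in
the cluster category C(Π) is isomorphic to Π[-l].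

The setting is axiomatized as a (d+1)-Calabi-Yau triple (per Π, pvd Π, Π) together
with its cluster category and quotient functor; the truncation Π^{≤-l} is
characterized by the truncation triangle Π^{≤-l} → Π → Π^{[-l+1,0]} and the
vanishing of the appropriate cohomologies Hom(Π[i], -).
-/

open CategoryTheory CategoryTheory.Limits CategoryTheory.Pretriangulated

universe w v u v' u'

section Defs

variable {E : Type*} [Category E] [Preadditive E] [HasZeroObject E] [HasShift E ℤ]
  [∀ n : ℤ, (CategoryTheory.shiftFunctor E n).Additive] [Pretriangulated E]
  [HasBinaryBiproducts E]

/-- The extension subcategory `X * Y`. -/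
def starSet (X Y : Set E) : Set E :=
  {T | ∃ A ∈ X, ∃ B ∈ Y, ∃ (f : A ⟶ T) (g : T ⟶ B) (h : B ⟶ A⟦(1:ℤ)⟧),
    Triangle.mk f g h ∈ distTriang E}

/-- The shift `S[n]` of a subcategory. -/
def shiftSet (S : Set E) (n : ℤ) : Set E := {X | ∃ A ∈ S, Nonempty (X ≅ A⟦n⟧)}

/-- Iterated extension subcategory. -/
def starList : List (Set E) → Set E
  | [] => {T | IsZero T}
  | [S] => S
  | S :: T :: rest => starSet S (starList (T :: rest))

/-- Objects obtained as finite direct sums of objects of `S`. -/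
inductive sums (S : Set E) : E → Prop
  | of {X : E} : X ∈ S → sums S X
  | biprod {X Y : E} : sums S X → sums S Y → sums S (X ⊞ Y)

/-- The additive closure `add S`. -/
def addSet (S : Set E) : Set E :=
  {X | ∃ Y Z : E, sums S Y ∧ Nonempty (Y ≅ X ⊞ Z)}

/-- A thick subcategory. -/
structure IsThick (Z : Set E) : Prop where
  iso : ∀ {X Y : E}, (X ≅ Y) → X ∈ Z → Y ∈ Z
  shift : ∀ X ∈ Z, ∀ n : ℤ, X⟦n⟧ ∈ Z
  ext₂ : ∀ T ∈ distTriang E, T.obj₁ ∈ Z → T.obj₃ ∈ Z → T.obj₂ ∈ Z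
  summand : ∀ X Y : E, (X ⊞ Y) ∈ Z → X ∈ Z

/-- An object `P` is presilting: Hom(P, P[i]) = 0 for i ≥ 1. -/
def IsPresiltingObj (P : E) : Prop :=
  ∀ i : ℤ, 1 ≤ i → ∀ f : P ⟶ P⟦i⟧, f = 0

/-- An object `P` is silting: presilting and `thick P` is everything. -/
def IsSiltingObj (P : E) : Prop :=
  IsPresiltingObj P ∧ ∀ Z : Set E, IsThick Z → P ∈ Z → ∀ X : E, X ∈ Z

/-- A `d`-cluster tilting object of a `d`-Calabi-Yau triangulated category:
`add T` is `d`-rigid, equal to both perpendicular categories, and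
`E = add T * (add T)[1] * ... * (add T)[d-1]`. -/
structure IsDCTObj (d : ℕ) (T : E) : Prop where
  rigid : ∀ i : ℤ, 1 ≤ i → i ≤ (d : ℤ) - 1 → ∀ f : T ⟶ T⟦i⟧, f = 0
  perp_left : ∀ X : E,
    (∀ i : ℤ, 1 ≤ i → i ≤ (d : ℤ) - 1 → ∀ f : T ⟶ X⟦i⟧, f = 0) →
      X ∈ addSet ({T} : Set E)
  perp_right : ∀ X : E,
    (∀ i : ℤ, 1 ≤ i → i ≤ (d : ℤ) - 1 → ∀ f : X ⟶ T⟦i⟧, f = 0) →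
      X ∈ addSet ({T} : Set E)
  gen : ∀ X : E,
    X ∈ starList ((List.range d).map fun i => shiftSet (addSet ({T} : Set E)) (i : ℤ))

end Defs

variable (k : Type w) [Field k]

-- `D` plays the role of the perfect derived category `per Π` of a connective,
-- `H⁰`-finite, `(d+1)`-Calabi-Yau dg algebra `Π`.
variable (D : Type u) [Category.{v} D] [Preadditive D] [Linear k D] [HasZeroObject D]
  [HasShift D ℤ] [∀ n : ℤ, (CategoryTheory.shiftFunctor D n).Additive] [Pretriangulated D]
  [HasBinaryBiproducts D] [∀ X Y : D, FiniteDimensional k (X ⟶ Y)]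
  [IsIdempotentComplete D]

/-- The data of a `(d+1)`-Calabi-Yau triple `(D, fd, Π)`: `Π` is a silting object
(Π is connective), `fd` is a thick subcategory (the perfectly valued derived
category `pvd Π`) satisfying relative Serre duality in degree `d+1`, containing
`Π[>0]^⊥`, and the pair `(Π[<0]^⊥, Π[>0]^⊥)` is a t-structure. -/
structure CYTripleData (d : ℕ) (Pi : D) (fd : Set D) where
  silting : IsSiltingObj Pi
  thick : IsThick fd
  serre : ∀ X ∈ fd, ∀ Y : D,
    (Y ⟶ X⟦((d : ℤ) + 1)⟧) ≃ₗ[k] Module.Dual k (X ⟶ Y)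
  fdGE : ∀ X : D, (∀ i : ℤ, 0 < i → ∀ f : Pi⟦i⟧ ⟶ X, f = 0) → X ∈ fd
  tdecomp : ∀ T : D, ∃ (A B : D) (f : A ⟶ T) (g : T ⟶ B) (h : B ⟶ A⟦(1:ℤ)⟧),
    (∀ i : ℤ, i < 0 → ∀ u : Pi⟦i⟧ ⟶ A, u = 0) ∧
    (∀ i : ℤ, 0 ≤ i → ∀ u : Pi⟦i⟧ ⟶ B, u = 0) ∧
    Triangle.mk f g h ∈ distTriang D

-- `Cl` plays the role of the cluster category `C(Π) = per Π / pvd Π`, and `π` the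
-- canonical quotient functor.
variable (Cl : Type u') [Category.{v'} Cl] [Preadditive Cl] [HasZeroObject Cl]
  [HasShift Cl ℤ] [∀ n : ℤ, (CategoryTheory.shiftFunctor Cl n).Additive]
  [Pretriangulated Cl] [HasBinaryBiproducts Cl]
variable (quot : D ⥤ Cl) [quot.CommShift ℤ] [quot.IsTriangulated] [quot.Additive]

/-- The fundamental domain `F = add Π * (add Π)[1] * ... * (add Π)[d-1] ⊆ per Π`. -/
def InFD (Pi : D) (d : ℕ) (X : D) : Prop :=
  X ∈ starList ((List.range d).map fun i => shiftSet (addSet ({Pi} : Set D)) (i : ℤ))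

/-- `Π` is F-liftable: every `d`-cluster tilting object of the cluster category is
the image of a silting object lying in the fundamental domain `F`. -/
def FLiftable (Pi : D) (d : ℕ) : Prop :=
  ∀ T : Cl, IsDCTObj d T →
    ∃ P : D, IsSiltingObj P ∧ InFD D Pi d P ∧ Nonempty (quot.obj P ≅ T)

section Helpers

set_option linter.unusedSectionVars false

variable {E : Type*} [Category E] [Preadditive E] [HasZeroObject E] [HasShift E ℤ]
  [∀ n : ℤ, (CategoryTheory.shiftFunctor E n).Additive] [Pretriangulated E]

/-- Vanishing of `Hom(W, Z[n])`. -/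
def VanH (W Z : E) (n : ℤ) : Prop := ∀ f : W ⟶ Z⟦n⟧, f = 0

lemma VanH.isoL {W W' Z : E} {n : ℤ} (e : W ≅ W') (h : VanH W Z n) : VanH W' Z n := by
  intro f
  rw [← cancel_epi e.hom, comp_zero]
  exact h _

lemma VanH.isoR {W Z Z' : E} {n m : ℤ} (e : Z⟦n⟧ ≅ Z'⟦m⟧) (h : VanH W Z n) : VanH W Z' m := by
  intro f
  rw [← cancel_mono e.inv, zero_comp]
  exact h _

lemma VanH.shiftR {W Z : E} {m n s : ℤ} (hs : m + n = s) : VanH W (Z⟦m⟧) n ↔ VanH W Z s :=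
  ⟨fun h f => by
      rw [← cancel_mono ((shiftFunctorAdd' E m n s hs).app Z).hom, zero_comp]; exact h _,
   fun h f => by
      rw [← cancel_mono ((shiftFunctorAdd' E m n s hs).app Z).inv, zero_comp]; exact h _⟩

lemma hom_shift_zero {A B : E} (n : ℤ) (h : ∀ f : A⟦n⟧ ⟶ B⟦n⟧, f = 0) (f : A ⟶ B) : f = 0 := by
  apply (shiftFunctor E n).map_injective
  rw [Functor.map_zero]
  exact h _

lemma hom_shift_zero' {A B : E} (n : ℤ) (h : ∀ f : A ⟶ B, f = 0) (f : A⟦n⟧ ⟶ B⟦n⟧) : f = 0 := by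
  obtain ⟨g, rfl⟩ := (shiftFunctor E n).map_surjective f
  rw [h g, Functor.map_zero]

lemma VanH.shiftL {W Z : E} {m n s : ℤ} (hs : s + m = n) : VanH (W⟦m⟧) Z n ↔ VanH W Z s :=
  ⟨fun h => fun f => hom_shift_zero m ((VanH.shiftR hs).2 h) f,
   fun h => (VanH.shiftR hs).1 (fun f => hom_shift_zero' m h f)⟩

lemma VanH.zeroR {W Z : E} : VanH W Z 0 ↔ ∀ f : W ⟶ Z, f = 0 :=
  ⟨fun h f => by
      rw [← cancel_mono ((shiftFunctorZero E ℤ).app Z).inv, zero_comp]; exact h _,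
   fun h f => by
      rw [← cancel_mono ((shiftFunctorZero E ℤ).app Z).hom, zero_comp]; exact h _⟩

/-- `Hom(W[m], Z) = 0` in terms of `VanH`. -/
lemma VanH.fromShift {W Z : E} {m s : ℤ} (hs : s + m = 0) :
    (∀ f : W⟦m⟧ ⟶ Z, f = 0) ↔ VanH W Z s := by
  rw [← VanH.zeroR, VanH.shiftL hs]

lemma VanH.covar {T : Triangle E} (hT : T ∈ distTriang E) {W : E} {n : ℤ}
    (h₁ : VanH W T.obj₁ n) (h₃ : VanH W T.obj₃ n) : VanH W T.obj₂ n := by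
  intro f
  obtain ⟨g, hg⟩ := Triangle.coyoneda_exact₂ _ (Triangle.shift_distinguished T hT n) f (h₃ _)
  have : g = 0 := h₁ g
  rw [this] at hg
  exact hg.trans zero_comp

lemma VanH.contra {T : Triangle E} (hT : T ∈ distTriang E) {Z : E} {n : ℤ}
    (h₁ : VanH T.obj₁ Z n) (h₃ : VanH T.obj₃ Z n) : VanH T.obj₂ Z n := by
  intro f
  obtain ⟨g, hg⟩ := Triangle.yoneda_exact₂ T hT f (h₁ _)
  rw [hg, h₃ g, comp_zero]

/-- `Hom(W, obj₃[n])`. -/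
lemma VanH.covar₃ {T : Triangle E} (hT : T ∈ distTriang E) {W : E} {n m : ℤ} (hm : 1 + n = m)
    (h₂ : VanH W T.obj₂ n) (h₁ : VanH W T.obj₁ m) : VanH W T.obj₃ n :=
  VanH.covar (rot_of_distTriang _ hT) h₂ ((VanH.shiftR hm).2 h₁)

/-- `Hom(W, obj₁[m])`. -/
lemma VanH.covar₁ {T : Triangle E} (hT : T ∈ distTriang E) {W : E} {n m : ℤ} (hm : 1 + n = m)
    (h₃ : VanH W T.obj₃ n) (h₂ : VanH W T.obj₂ m) : VanH W T.obj₁ m :=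
  (VanH.shiftR hm).1
    (VanH.covar (rot_of_distTriang _ (rot_of_distTriang _ hT)) h₃ ((VanH.shiftR hm).2 h₂))

/-- `Hom(obj₁, Z[n])`. -/
lemma VanH.contra₁ {T : Triangle E} (hT : T ∈ distTriang E) {Z : E} {n m : ℤ} (hm : n + 1 = m)
    (h₂ : VanH T.obj₂ Z n) (h₃ : VanH T.obj₃ Z m) : VanH T.obj₁ Z n :=
  (VanH.shiftL hm).1
    (VanH.contra (rot_of_distTriang _ (rot_of_distTriang _ hT)) h₃ ((VanH.shiftL hm).2 h₂))

variable [HasBinaryBiproducts E]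

lemma VanH.sumsR {Pi W P : E} (hP : sums ({Pi} : Set E) P) {n : ℤ} (h : VanH W Pi n) :
    VanH W P n := by
  induction hP with
  | of hX => rw [Set.mem_singleton_iff.1 hX]; exact h
  | biprod _ _ h₁ h₂ => exact VanH.covar (binaryBiproductTriangle_distinguished _ _) h₁ h₂

lemma VanH.sumsL {Pi Z P : E} (hP : sums ({Pi} : Set E) P) {n : ℤ} (h : VanH Pi Z n) :
    VanH P Z n := by
  induction hP with
  | of hX => rw [Set.mem_singleton_iff.1 hX]; exact h
  | biprod _ _ h₁ h₂ => exact VanH.contra (binaryBiproductTriangle_distinguished _ _) h₁ h₂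

/-- `Hom(Pi, X[>0]) = 0`. -/
def ConnH (Pi X : E) : Prop := ∀ i : ℤ, 1 ≤ i → VanH Pi X i

lemma exists_list_approx (Pi X : E) (L : List (Pi ⟶ X)) :
    ∃ (P : E) (p : P ⟶ X), sums ({Pi} : Set E) P ∧ ∀ u ∈ L, ∃ v : Pi ⟶ P, v ≫ p = u := by
  induction L with
  | nil => exact ⟨Pi, 0, sums.of rfl, by simp⟩
  | cons a L ih =>
    obtain ⟨P, p, hP, h⟩ := ih
    refine ⟨P ⊞ Pi, biprod.desc p a, sums.biprod hP (sums.of rfl), ?_⟩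
    intro u hu
    rcases List.mem_cons.1 hu with rfl | hu
    · exact ⟨biprod.inr, by simp⟩
    · obtain ⟨v, hv⟩ := h u hu
      exact ⟨v ≫ biprod.inl, by simp [hv]⟩

lemma exists_approx (k : Type*) [Field k] [Linear k E] (Pi X : E)
    [FiniteDimensional k (Pi ⟶ X)] :
    ∃ (P : E) (p : P ⟶ X), sums ({Pi} : Set E) P ∧ ∀ u : Pi ⟶ X, ∃ v : Pi ⟶ P, v ≫ p = u := by
  obtain ⟨S, hS⟩ := (inferInstance : Module.Finite k (Pi ⟶ X)).fg_top
  obtain ⟨P, p, hP, h⟩ := exists_list_approx Pi X S.toList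
  refine ⟨P, p, hP, fun u => ?_⟩
  have hle : Submodule.span k (S : Set (Pi ⟶ X)) ≤
      LinearMap.range (Linear.rightComp k Pi p) := by
    rw [Submodule.span_le]
    intro u hu
    obtain ⟨v, hv⟩ := h u (by simpa using hu)
    exact ⟨v, hv⟩
  rw [hS] at hle
  obtain ⟨v, hv⟩ := hle (Submodule.mem_top : u ∈ ⊤)
  exact ⟨v, hv⟩

lemma exists_approx_triangle (k : Type*) [Field k] [Linear k E] {Pi X : E}
    [FiniteDimensional k (Pi ⟶ X)] (hPi : ConnH Pi Pi) (hX : ConnH Pi X) :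
    ∃ T ∈ distTriang E, T.obj₃ = X ∧ sums ({Pi} : Set E) T.obj₂ ∧ ConnH Pi T.obj₁ := by
  obtain ⟨P, p, hP, hp⟩ := exists_approx k Pi X
  obtain ⟨X₁, i, δ, hT⟩ := distinguished_cocone_triangle₁ p
  refine ⟨_, hT, rfl, hP, ?_⟩
  intro n hn
  rcases hn.eq_or_lt with rfl | hn
  · intro f
    obtain ⟨u, hu⟩ := Triangle.coyoneda_exact₁ _ hT f
      (VanH.sumsR hP (hPi 1 le_rfl) _)
    obtain ⟨v, hv⟩ := hp u
    have h23 : p ≫ δ = 0 := comp_distTriang_mor_zero₂₃ _ hT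
    have h0 : (v ≫ p) ≫ δ = 0 := by rw [Category.assoc, h23, comp_zero]
    rw [hv] at h0
    exact hu.trans h0
  · exact VanH.covar₁ hT (n := n - 1) (by ring) (hX _ (by omega))
      (VanH.sumsR hP (hPi n (by omega)))

lemma exists_bound {Pi : E} (hs : IsSiltingObj Pi) (X : E) :
    ∃ N : ℤ, ∀ Z : E, ConnH Pi Z → ∀ m : ℤ, N ≤ m → VanH X Z m := by
  refine hs.2 {X : E | ∃ N : ℤ, ∀ Z : E, ConnH Pi Z → ∀ m : ℤ, N ≤ m → VanH X Z m} ?_ ?_ X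
  · constructor
    · rintro X Y e ⟨N, hN⟩
      exact ⟨N, fun Z hZ m hm => (hN Z hZ m hm).isoL e⟩
    · rintro X ⟨N, hN⟩ n
      exact ⟨N + n, fun Z hZ m hm =>
        (VanH.shiftL (s := m - n) (by ring)).2 (hN Z hZ _ (by omega))⟩
    · rintro T hT ⟨N, hN⟩ ⟨N', hN'⟩
      exact ⟨max N N', fun Z hZ m hm => VanH.contra hT
        (hN Z hZ m (le_trans (le_max_left _ _) hm)) (hN' Z hZ m (le_trans (le_max_right _ _) hm))⟩
    · rintro X Y ⟨N, hN⟩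
      refine ⟨N, fun Z hZ m hm f => ?_⟩
      have := hN Z hZ m hm (biprod.fst ≫ f)
      rw [← cancel_epi (biprod.fst : X ⊞ Y ⟶ X), this, comp_zero]
  · exact ⟨1, fun Z hZ m hm => hZ m hm⟩

lemma van_of_coconn (k : Type*) [Field k] [Linear k E] [∀ X Y : E, FiniteDimensional k (X ⟶ Y)]
    {Pi : E} (hs : IsSiltingObj Pi) (X : E) (hX : ∀ i : ℤ, 1 ≤ i → VanH X Pi i) :
    ∀ Z : E, ConnH Pi Z → ∀ m : ℤ, 1 ≤ m → VanH X Z m := by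
  obtain ⟨N, hN⟩ := exists_bound hs X
  have key : ∀ n : ℕ, ∀ Z : E, ConnH Pi Z → ∀ m : ℤ, 1 ≤ m → N - n ≤ m → VanH X Z m := by
    intro n
    induction n with
    | zero => intro Z hZ m _ hm; exact hN Z hZ m (by simpa using hm)
    | succ n ih =>
      intro Z hZ m h1 hm
      obtain ⟨T, hT, rfl, hP, hT1⟩ := exists_approx_triangle k hs.1 hZ
      exact VanH.covar₃ hT rfl (VanH.sumsR hP (hX m h1))
        (ih _ hT1 _ (by omega) (by push_cast at hm; omega))
  intro Z hZ m hm
  exact key (N - m).toNat Z hZ m hm (by omega)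

lemma mem_add (k : Type*) [Field k] [Linear k E] [∀ X Y : E, FiniteDimensional k (X ⟶ Y)]
    {Pi : E} (hs : IsSiltingObj Pi) {X : E} (hc : ConnH Pi X)
    (hX : ∀ i : ℤ, 1 ≤ i → VanH X Pi i) : X ∈ addSet ({Pi} : Set E) := by
  obtain ⟨T, hT, rfl, hP, hT1⟩ := exists_approx_triangle k hs.1 hc
  obtain ⟨e, -⟩ := exists_iso_binaryBiproduct_of_distTriang T hT
    (van_of_coconn k hs _ hX _ hT1 1 le_rfl T.mor₃)
  exact ⟨T.obj₂, T.obj₁, hP, ⟨e ≪≫ biprod.braiding _ _⟩⟩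

open ZeroObject in
lemma sums_mem_add {S : Set E} {P : E} (hP : sums S P) : P ∈ addSet S :=
  ⟨P, 0, hP, ⟨(isoBiprodZero (isZero_zero E))⟩⟩

lemma mem_dist_of_iso₂ {R : Triangle E} (hR : R ∈ distTriang E) {W : E} (e : W ≅ R.obj₂) :
    ∃ (f : R.obj₁ ⟶ W) (g : W ⟶ R.obj₃) (h : R.obj₃ ⟶ R.obj₁⟦(1:ℤ)⟧),
      Triangle.mk f g h ∈ distTriang E := by
  refine ⟨R.mor₁ ≫ e.inv, e.hom ≫ R.mor₂, R.mor₃, isomorphic_distinguished _ hR _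
    (Triangle.isoMk _ R (Iso.refl R.obj₁) e (Iso.refl R.obj₃) ?_ ?_ ?_)⟩
  · change (R.mor₁ ≫ e.inv) ≫ e.hom = 𝟙 _ ≫ R.mor₁
    simp
  · change (e.hom ≫ R.mor₂) ≫ 𝟙 _ = e.hom ≫ R.mor₂
    simp
  · change R.mor₃ ≫ (𝟙 R.obj₁)⟦(1:ℤ)⟧' = 𝟙 _ ≫ R.mor₃
    simp

lemma mem_starList (k : Type*) [Field k] [Linear k E] [∀ X Y : E, FiniteDimensional k (X ⟶ Y)]
    {Pi : E} (hs : IsSiltingObj Pi) (n : ℕ) :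
    ∀ (X : E) (_ : ConnH Pi X) (_ : ∀ i : ℤ, (n : ℤ) + 1 ≤ i → VanH X Pi i) (s : ℤ) (W : E)
      (_ : W ≅ X⟦s⟧),
      W ∈ starList ((List.range (n + 1)).map
        fun i : ℕ => shiftSet (addSet ({Pi} : Set E)) (s + (i : ℤ))) := by
  induction n with
  | zero =>
    intro X hc hX s W e
    have : X ∈ addSet ({Pi} : Set E) := mem_add k hs hc (fun i hi => hX i (by simpa using hi))
    have h2 : W ∈ shiftSet (addSet ({Pi} : Set E)) s := ⟨X, this, ⟨e⟩⟩
    simpa [starList] using h2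
  | succ n ih =>
    intro X hc hX s W e
    obtain ⟨T, hT, rfl, hP, hT1⟩ := exists_approx_triangle k hs.1 hc
    have h1 : ∀ i : ℤ, (n : ℤ) + 1 ≤ i → VanH T.obj₁ Pi i := fun i hi =>
      VanH.contra₁ hT rfl (VanH.sumsL hP (hs.1 i (by omega)))
        (hX (i + 1) (by push_cast; omega))
    have ih1 := ih T.obj₁ hT1 h1 (1 + s) ((T.obj₁⟦(1:ℤ)⟧)⟦s⟧)
      ((shiftFunctorAdd E 1 s).app T.obj₁).symm
    have hl : ((List.range (n + 1)).map
        fun i : ℕ => shiftSet (addSet ({Pi} : Set E)) ((1 + s) + (i : ℤ))) =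
        ((List.range (n + 1)).map Nat.succ).map
          fun i : ℕ => shiftSet (addSet ({Pi} : Set E)) (s + (i : ℤ)) := by
      rw [List.map_map]
      apply List.map_congr_left
      intro i _
      simp only [Function.comp, Nat.succ_eq_add_one]
      congr 1
      push_cast
      ring
    rw [hl] at ih1
    rw [List.range_succ_eq_map, List.map_cons]
    have hne : ∀ (S : Set E) (L : List (Set E)), L ≠ [] →
        starList (S :: L) = starSet S (starList L) := by
      intro S L hL
      cases L with
      | nil => exact absurd rfl hL
      | cons => rfl
    rw [hne _ _ (by simp)]
    have hR := Triangle.shift_distinguished _ (rot_of_distTriang _ hT) s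
    refine ⟨T.obj₂⟦s⟧, ⟨T.obj₂, sums_mem_add hP, ⟨eqToIso (by simp)⟩⟩, _, ih1, ?_⟩
    let R := (shiftFunctor (Triangle E) s).obj T.rotate
    let e' : W ≅ R.obj₂ := e
    exact mem_dist_of_iso₂ hR e'

end Helpers

theorem statement_13
    (d : ℕ) (hd : 1 ≤ d) (Pi : D) (fd : Set D) (cy : CYTripleData k D d Pi fd)
    -- the quotient functor kills exactly `fd` and is essentially surjective
    (hkill : ∀ X : D, IsZero (quot.obj X) ↔ X ∈ fd)
    (hsurj : ∀ Y : Cl, ∃ X : D, Nonempty (quot.obj X ≅ Y))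
    (l : ℕ)
    -- the truncation triangle  X = Π^{≤-l} → Π → Y = Π^{[-l+1,0]} → X[1]
    (X Y : D) (f : X ⟶ Pi) (g : Pi ⟶ Y) (h : Y ⟶ X⟦(1:ℤ)⟧)
    (htri : Triangle.mk f g h ∈ distTriang D)
    (hX : ∀ i : ℤ, i < (l : ℤ) → ∀ u : Pi⟦i⟧ ⟶ X, u = 0)
    (hY : ∀ i : ℤ, (l : ℤ) ≤ i → ∀ u : Pi⟦i⟧ ⟶ Y, u = 0) :
    InFD D Pi d (X⟦(-(l : ℤ))⟧) ∧ Y ∈ fd ∧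
      Nonempty (quot.obj (X⟦(-(l : ℤ))⟧) ≅ (quot.obj Pi)⟦(-(l : ℤ))⟧) := by
  have hPiPi : ConnH Pi Pi := cy.silting.1
  have hYv : ∀ j : ℤ, j ≤ -(l : ℤ) → VanH Pi Y j := fun j hj =>
    (VanH.fromShift (m := -j) (by ring)).1 (hY (-j) (by omega))
  have hXv : ∀ j : ℤ, -(l : ℤ) < j → VanH Pi X j := fun j hj =>
    (VanH.fromShift (m := -j) (by ring)).1 (hX (-j) (by omega))
  have hYfd : Y ∈ fd := by
    have h1 : Y⟦(-(l : ℤ))⟧ ∈ fd := by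
      apply cy.fdGE
      intro i hi
      rw [VanH.fromShift (s := -i) (by ring), VanH.shiftR rfl]
      exact hYv _ (by omega)
    exact cy.thick.iso ((shiftFunctorCompIsoId D (-(l : ℤ)) l (by ring)).app Y)
      (cy.thick.shift _ h1 l)
  have hYPi : ∀ m : ℤ, (d : ℤ) + 1 + l ≤ m → VanH Y Pi m := by
    intro m hm f
    have hz : ∀ u : Pi⟦m⟧ ⟶ Y⟦((d : ℤ) + 1)⟧, u = 0 := by
      rw [VanH.fromShift (s := -m) (by ring), VanH.shiftR rfl]
      exact hYv _ (by omega)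
    have hdual : ∀ φ : Module.Dual k (Y ⟶ Pi⟦m⟧), φ = 0 := by
      intro φ
      have := hz ((cy.serre Y hYfd (Pi⟦m⟧)).symm φ)
      simpa using this
    exact (Module.forall_dual_apply_eq_zero_iff k f).1 (fun φ => by rw [hdual φ]; rfl)
  refine ⟨?_, hYfd, ?_⟩
  · obtain ⟨n, rfl⟩ : ∃ n, d = n + 1 := ⟨d - 1, by omega⟩
    have hmem := mem_starList k cy.silting n (X⟦(-(l : ℤ))⟧)
      (fun i hi => (VanH.shiftR rfl).2 (hXv _ (by omega)))
      (fun i hi => (VanH.shiftL (s := i + l) (by ring)).2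
        (VanH.contra₁ htri rfl (hPiPi _ (by omega)) (hYPi _ (by push_cast; omega))))
      0 _ ((shiftFunctorZero D ℤ).app _).symm
    have hl : (do let a ← List.range (n + 1); pure (a : ℤ)) =
        (List.range (n + 1)).map (fun a : ℕ => (a : ℤ)) := by
      exact List.map_eq_flatMap.symm
    simp only [zero_add] at hmem
    unfold InFD
    rw [hl, List.map_map]
    exact hmem
  · have hz : IsZero (quot.obj Y) := (hkill Y).2 hYfd
    have hiso : IsIso (quot.map f) :=
      (Triangle.isZero₃_iff_isIso₁ _ (quot.map_distinguished _ htri)).1 hz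
    exact ⟨(quot.commShiftIso (-(l : ℤ))).app X ≪≫
      (shiftFunctor Cl (-(l : ℤ))).mapIso (asIso (quot.map f))⟩
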